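/- Let a, c be real numbers with 0 < a < 1 and c ∉ {0,−1,−2,…}, and let 𝓕 = (F_1,F_2) be a pair of finite sets of positive integers, not both empty, such that c and 𝓕 are admissible. Then for every r ∈ σ_𝓕: ∑_{n=0}^∞ (m_r^{a,c;𝓕}(n))²·a^n·Γ(n+c+k)/(n!·Ω_𝓕^{a,c}(n)·Ω_𝓕^{a,c}(n+1)) = (a^{k_1−2k}/(1−a)^{c+2r−2u_𝓕−k}) · ∏_{f∈F_1}(r−f−u_𝓕)·∏_{f∈F_2}(r+c+f−u_𝓕)·a^{r−u_𝓕}·Γ(r+c−u_𝓕)/(r−u_𝓕)!. -/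

import Mathlib

open Finset MeasureTheory Polynomial

/-- Generalized binomial coefficient `C(t, j) = t(t-1)⋯(t-j+1)/j!`. -/
noncomputable def gbinom (t : ℝ) (j : ℕ) : ℝ :=
  (∏ i ∈ Finset.range j, (t - i)) / (Nat.factorial j)

/-- Pochhammer symbol `(t)_m = t(t+1)⋯(t+m-1)`. -/
noncomputable def poch (t : ℝ) (m : ℕ) : ℝ := ∏ i ∈ Finset.range m, (t + i)

/-- Pochhammer symbol with integer index (Γ-quotient convention for negative index). -/
noncomputable def pochZ (t : ℝ) (m : ℤ) : ℝ :=
  if 0 ≤ m then ∏ i ∈ Finset.range m.toNat, (t + i)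
  else (∏ i ∈ Finset.range (-m).toNat, (t - (i + 1)))⁻¹

/-- `ĉ = max(-⌊c⌋, 0)`. -/
noncomputable def chat (c : ℝ) : ℕ := (-⌊c⌋).toNat

/-- Admissibility of `c` and the pair `𝓕 = (F₁, F₂)`. -/
def IsAdmissible (c : ℝ) (F1 F2 : Finset ℕ) : Prop :=
  ∀ x : ℕ, 0 ≤ (∏ f ∈ F1, ((x : ℝ) - f)) * (∏ f ∈ F2, ((x : ℝ) + c + f)) /
    poch ((x : ℝ) + c) (chat c)

/-- `u_𝓕 = ∑_{f∈F₁} f + ∑_{f∈F₂} f - C(k₁+1, 2) - C(k₂, 2)`. -/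
def uF (F1 F2 : Finset ℕ) : ℕ :=
  (∑ f ∈ F1, f + ∑ f ∈ F2, f) - (Nat.choose (F1.card + 1) 2 + Nat.choose F2.card 2)

/-- `σ_𝓕 = {u_𝓕, u_𝓕+1, …} \ {u_𝓕 + f : f ∈ F₁}`. -/
def sigmaF (F1 F2 : Finset ℕ) : Set ℕ :=
  {n | uF F1 F2 ≤ n ∧ ∀ f ∈ F1, n ≠ uF F1 F2 + f}

/-- The `i`-th element (0-based) of `F` in increasing order. -/
def nth (F : Finset ℕ) (i : ℕ) : ℕ := (F.sort (· ≤ ·)).getD i 0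
/-- The Meixner polynomial `m_n^{a,c}` evaluated at `x`. -/
noncomputable def meixner (a c : ℝ) (n : ℕ) (x : ℝ) : ℝ :=
  (a / (1 - a)) ^ n *
    ∑ j ∈ Finset.range (n + 1), a ^ (-(j : ℤ)) * gbinom x j * gbinom (-x - c) (n - j)

/-- The polynomial `m_n^{a,c;𝓕}` (Casorati determinant of Meixner polynomials). -/
noncomputable def mExc (a c : ℝ) (F1 F2 : Finset ℕ) (n : ℕ) (x : ℝ) : ℝ :=
  Matrix.det (Matrix.of fun i j : Fin (F1.card + F2.card + 1) =>
    if (i : ℕ) = 0 then meixner a c (n - uF F1 F2) (x + ((j : ℕ) : ℝ))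
    else if (i : ℕ) - 1 < F1.card then meixner a c (nth F1 ((i : ℕ) - 1)) (x + ((j : ℕ) : ℝ))
    else a ^ (-((j : ℕ) : ℤ)) *
      meixner a⁻¹ c (nth F2 ((i : ℕ) - 1 - F1.card)) (x + ((j : ℕ) : ℝ)))

/-- The Casorati determinant `Ω_𝓕^{a,c}(x)`. -/
noncomputable def OmegaM (a c : ℝ) (F1 F2 : Finset ℕ) (x : ℝ) : ℝ :=
  Matrix.det (Matrix.of fun i j : Fin (F1.card + F2.card) =>
    if (i : ℕ) < F1.card then meixner a c (nth F1 (i : ℕ)) (x + ((j : ℕ) : ℝ))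
    else a ^ (-((j : ℕ) : ℤ)) *
      meixner a⁻¹ c (nth F2 ((i : ℕ) - F1.card)) (x + ((j : ℕ) : ℝ)))

/-- The determinant `Λ_𝓕^{a,c}(x)` (columns `0, …, k-2, k`). -/
noncomputable def LambdaM (a c : ℝ) (F1 F2 : Finset ℕ) (x : ℝ) : ℝ :=
  Matrix.det (Matrix.of fun i j : Fin (F1.card + F2.card) =>
    let col : ℕ := if (j : ℕ) = F1.card + F2.card - 1 then F1.card + F2.card else (j : ℕ)
    if (i : ℕ) < F1.card then meixner a c (nth F1 (i : ℕ)) (x + (col : ℝ))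
    else a ^ (-(col : ℤ)) *
      meixner a⁻¹ c (nth F2 ((i : ℕ) - F1.card)) (x + (col : ℝ)))
/-- The polynomial `q_n^𝓕` (Christoffel-transform dual of `m_n^{a,c;𝓕}`). -/
noncomputable def qExc (a c : ℝ) (F1 F2 : Finset ℕ) (n : ℕ) (x : ℝ) : ℝ :=
  Matrix.det (Matrix.of fun i j : Fin (F1.card + F2.card + 1) =>
    if (i : ℕ) = 0 then meixner a c (n + (j : ℕ)) (x - (uF F1 F2 : ℝ))
    else if (i : ℕ) - 1 < F1.card then
      meixner a c (n + (j : ℕ)) ((nth F1 ((i : ℕ) - 1) : ℝ))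
    else (-1 : ℝ) ^ (j : ℕ) *
      meixner a⁻¹ c (n + (j : ℕ)) ((nth F2 ((i : ℕ) - 1 - F1.card) : ℝ))) /
  ((-1 : ℝ) ^ (n * F2.card) * (∏ f ∈ F1, (x - (f : ℝ) - (uF F1 F2 : ℝ))) *
    ∏ f ∈ F2, (x + c + (f : ℝ) - (uF F1 F2 : ℝ)))

/-- The second order difference operator `D_𝓕` of Theorem 3.3. -/
noncomputable def DopM (a c : ℝ) (F1 F2 : Finset ℕ) (g : ℝ → ℝ) (x : ℝ) : ℝ :=
  (x * OmegaM a c F1 F2 (x + 1) / ((a - 1) * OmegaM a c F1 F2 x)) * g (x - 1)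
  + (-((1 + a) * (x + ((F1.card + F2.card : ℕ) : ℝ)) + a * c) / (a - 1) + (uF F1 F2 : ℝ)
      + a * (x + c + ((F1.card + F2.card : ℕ) : ℝ)) * LambdaM a c F1 F2 (x + 1) /
          ((a - 1) * OmegaM a c F1 F2 (x + 1))
      - a * (x + c + ((F1.card + F2.card : ℕ) : ℝ) - 1) * LambdaM a c F1 F2 x /
          ((a - 1) * OmegaM a c F1 F2 x)) * g x
  + (a * (x + c + ((F1.card + F2.card : ℕ) : ℝ)) * OmegaM a c F1 F2 x /
      ((a - 1) * OmegaM a c F1 F2 (x + 1))) * g (x + 1)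

/-- The weight `w(x) = aˣ Γ(x+c+k)/(x! Ω(x) Ω(x+1))` on `ℕ`. -/
noncomputable def wM (a c : ℝ) (F1 F2 : Finset ℕ) (x : ℕ) : ℝ :=
  a ^ x * Real.Gamma ((x : ℝ) + c + ((F1.card + F2.card : ℕ) : ℝ)) /
    ((Nat.factorial x : ℝ) * OmegaM a c F1 F2 (x : ℝ) * OmegaM a c F1 F2 ((x : ℝ) + 1))


lemma poly_bound (p : ℝ[X]) (t : ℝ) (ht : 1 < t) :
    ∃ C : ℝ, 0 ≤ C ∧ ∀ s : ℕ, |p.eval (s : ℝ)| ≤ C * t ^ s := by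
  induction p using Polynomial.induction_on' with
  | add p q hp hq =>
    obtain ⟨C, hC, h1⟩ := hp
    obtain ⟨D, hD, h2⟩ := hq
    refine ⟨C + D, by positivity, fun s => ?_⟩
    rw [eval_add, add_mul]
    exact (abs_add_le _ _).trans (add_le_add (h1 s) (h2 s))
  | monomial n b =>
    have h := tendsto_pow_const_div_const_pow_of_one_lt n ht
    obtain ⟨M, hM⟩ := h.bddAbove_range
    have hM' : ∀ s : ℕ, (s : ℝ) ^ n / t ^ s ≤ M := fun s => hM ⟨s, rfl⟩
    have hM0 : 0 ≤ M := le_trans (by positivity) (hM' 0)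
    refine ⟨|b| * M, by positivity, fun s => ?_⟩
    have := hM' s
    rw [div_le_iff₀ (by positivity)] at this
    rw [eval_monomial, abs_mul, abs_of_nonneg (show (0 : ℝ) ≤ (s : ℝ) ^ n by positivity), mul_assoc]
    gcongr

lemma summable_poly_mul (μ : ℕ → ℝ) (t : ℝ) (ht : 1 < t)
    (hs : Summable fun s => |μ s| * t ^ s) (p : ℝ[X]) :
    Summable fun s : ℕ => p.eval (s : ℝ) * μ s := by
  obtain ⟨C, hC, h⟩ := poly_bound p t ht
  refine Summable.of_norm_bounded (hs.mul_left C) fun s => ?_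
  rw [Real.norm_eq_abs, abs_mul]
  calc _ ≤ C * t ^ s * |μ s| := by gcongr; exact h s
    _ = _ := by ring

lemma power_zero (b : ℕ → ℝ) (t : ℝ) (ht : 1 < t) (hs : Summable fun s => |b s| * t ^ s)
    (h : ∀ i : ℕ, ∑' s : ℕ, b s * (s.choose i : ℝ) = 0) : b = 0 := by
  have t0 : 0 < t := by linarith
  set p := FormalMultilinearSeries.ofScalars ℝ b with hp
  have hr : ENNReal.ofReal t ≤ p.radius := by
    have : ((t.toNNReal : NNReal) : ENNReal) ≤ p.radius := by
      apply FormalMultilinearSeries.le_radius_of_summable_norm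
      refine hs.congr fun s => ?_
      rw [hp, FormalMultilinearSeries.ofScalars_norm, Real.norm_eq_abs, Real.coe_toNNReal _ t0.le]
    exact this
  have hball : HasFPowerSeriesOnBall p.sum p 0 (ENNReal.ofReal t) :=
    (p.hasFPowerSeriesOnBall (lt_of_lt_of_le (by simpa using t0) hr)).mono (by simpa using t0) hr
  have hsum : ∀ z, p.sum z = ∑' s, b s * z ^ s := by
    intro z
    have := FormalMultilinearSeries.ofScalars_sum_eq (E := ℝ) b z
    simpa [FormalMultilinearSeries.ofScalarsSum] using this
  have hnear : ∀ u : ℝ, |u| < t - 1 → p.sum (1 + u) = 0 := by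
    intro u hu
    have hS : Summable (Function.uncurry fun (s i : ℕ) => b s * ((s.choose i : ℝ) * u ^ i)) := by
      rw [← summable_norm_iff]
      have hfin : ∀ s : ℕ, HasSum (fun i : ℕ => |b s| * ((s.choose i : ℝ) * |u| ^ i))
          (|b s| * (1 + |u|) ^ s) := by
        intro s
        have e : (1 + |u|) ^ s = ∑ i ∈ range (s + 1), ((s.choose i : ℝ) * |u| ^ i) := by
          rw [add_comm, add_pow]; simp [mul_comm]
        rw [e]
        apply HasSum.mul_left
        apply hasSum_sum_of_ne_finset_zero
        intro i hi
        rw [Nat.choose_eq_zero_of_lt (by simpa using hi)]; simp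
      rw [summable_prod_of_nonneg (fun _ => norm_nonneg _)]
      have e1 : ∀ s i : ℕ, ‖Function.uncurry (fun (s i : ℕ) => b s * ((s.choose i : ℝ) * u ^ i)) (s, i)‖
          = |b s| * ((s.choose i : ℝ) * |u| ^ i) := by
        intro s i; simp [Function.uncurry]
      simp only [e1]
      refine ⟨fun s => (hfin s).summable, ?_⟩
      simp only [fun s => (hfin s).tsum_eq]
      refine Summable.of_nonneg_of_le (fun s => by positivity) (fun s => ?_) hs
      gcongr; linarith
    rw [hsum]
    have e2 : ∀ s : ℕ, b s * (1 + u) ^ s = ∑' i : ℕ, b s * ((s.choose i : ℝ) * u ^ i) := by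
      intro s
      rw [tsum_eq_sum (s := range (s + 1)), ← Finset.mul_sum, add_comm, add_pow]
      · simp [mul_comm]
      · intro i hi
        rw [Nat.choose_eq_zero_of_lt (by simpa using hi)]; simp
    simp_rw [e2]
    rw [← hS.tsum_comm]
    have e3 : ∀ i : ℕ, ∑' s : ℕ, b s * ((s.choose i : ℝ) * u ^ i) = 0 := by
      intro i
      simp_rw [← mul_assoc]
      rw [tsum_mul_right, h, zero_mul]
    simp [e3]
  have hev : p.sum =ᶠ[nhds 1] 0 := by
    rw [Filter.eventuallyEq_iff_exists_mem]
    refine ⟨Metric.ball 1 (t - 1), Metric.ball_mem_nhds _ (by linarith), fun x hx => ?_⟩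
    have := hnear (x - 1) (by simpa [Real.dist_eq] using hx)
    simpa using this
  have hzero := hball.analyticOnNhd.eqOn_zero_of_preconnected_of_eventuallyEq_zero
    (z₀ := 1) ?_ ?_ hev
  · have h0 : p.sum =ᶠ[nhds 0] 0 := by
      rw [Filter.eventuallyEq_iff_exists_mem]
      exact ⟨_, Metric.eball_mem_nhds _ (by simpa using t0), hzero⟩
    have := hball.hasFPowerSeriesAt.eq_zero_of_eventually h0
    rwa [hp, FormalMultilinearSeries.ofScalars_series_eq_zero] at this
  · rw [Metric.eball_ofReal]
    exact (convex_ball _ _).isPreconnected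
  · rw [Metric.eball_ofReal]; simpa using ht



lemma tsum_sub {ρ : ℕ → ℝ} (f : ℕ → ℝ) (hf : ∀ s, ρ s = 0 → f s = 0) :
    ∑' s : {s : ℕ // ρ s ≠ 0}, f s = ∑' s, f s := by
  apply tsum_subtype_eq_of_support_subset (s := {s | ρ s ≠ 0})
  intro s hs h
  exact hs (hf s h)

lemma exists_choose_poly (i : ℕ) : ∃ p : ℝ[X], ∀ s : ℕ, p.eval (s : ℝ) = (s.choose i : ℝ) := by
  refine ⟨C ((i.factorial : ℝ)⁻¹) * descPochhammer ℝ i, fun s => ?_⟩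
  rw [eval_mul, eval_C, descPochhammer_eval_eq_descFactorial, Nat.descFactorial_eq_factorial_mul_choose]
  push_cast
  have : (i.factorial : ℝ) ≠ 0 := by positivity
  field_simp

lemma aux_ineq (g ρ t : ℝ) (hρ : 0 ≤ ρ) (ht : 0 ≤ t) (s : ℕ) :
    |g| * √ρ * √t ^ s ≤ g ^ 2 + ρ * t ^ s := by
  have e1 := Real.sq_sqrt hρ
  have e2 : (√t ^ s) ^ 2 = t ^ s := by
    rw [← pow_mul, mul_comm, pow_mul, Real.sq_sqrt ht]
  rw [← e2, ← sq_abs g]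
  have h0 := mul_nonneg (mul_nonneg (abs_nonneg g) (Real.sqrt_nonneg ρ))
    (pow_nonneg (Real.sqrt_nonneg t) s)
  have h1 := sq_nonneg (|g| - √ρ * √t ^ s)
  have h2 : ρ * (√t ^ s) ^ 2 = (√ρ * √t ^ s) ^ 2 := by rw [mul_pow, e1]
  rw [h2]
  nlinarith

theorem parseval_poly (ρ : ℕ → ℝ) (hρ : ∀ s, 0 ≤ ρ s) (t : ℝ) (ht : 1 < t)
    (hs : Summable fun s => |ρ s| * t ^ s) (q : ℕ → ℝ[X]) (hq : ∀ n, (q n).degree = n)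
    (h : ℕ → ℝ) (hpos : ∀ n, 0 < h n)
    (horth : ∀ m n, ∑' s : ℕ, (q m * q n).eval (s : ℝ) * ρ s = if m = n then h n else 0)
    (s0 : ℕ) (hs0 : ρ s0 ≠ 0) :
    HasSum (fun n => (q n).eval (s0 : ℝ) ^ 2 / h n) (1 / ρ s0) := by
  classical
  let S := {s : ℕ // ρ s ≠ 0}
  let vf : ℝ[X] → S → ℝ := fun p s => √(ρ s) * p.eval (s.1 : ℝ)
  have hmem : ∀ p : ℝ[X], Memℓp (vf p) 2 := by
    intro p
    rw [memℓp_gen_iff (by norm_num)]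
    have := (summable_poly_mul ρ t ht hs (p ^ 2)).comp_injective
      (i := (Subtype.val : S → ℕ)) Subtype.val_injective
    refine this.congr fun s => ?_
    have h2 := Real.sq_sqrt (hρ s)
    simp only [vf, Function.comp, eval_pow, ENNReal.toReal_ofNat, Real.rpow_two,
      Real.norm_eq_abs, sq_abs, mul_pow, h2]
    ring
  let w : ℝ[X] → lp (fun _ : S => ℝ) 2 := fun p => ⟨vf p, hmem p⟩
  have hw : ∀ p s, (w p : S → ℝ) s = √(ρ s) * p.eval (s.1 : ℝ) := fun p s => rfl
  have hwadd : ∀ p p', w (p + p') = w p + w p' := by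
    intro p p'
    ext s
    simp only [hw, lp.coeFn_add, Pi.add_apply, eval_add]; ring
  have hwsmul : ∀ (r : ℝ) p, w (r • p) = r • w p := by
    intro r p
    ext s
    simp only [hw, lp.coeFn_smul, Pi.smul_apply, eval_smul, smul_eq_mul]; ring
  let W : ℝ[X] →ₗ[ℝ] lp (fun _ : S => ℝ) 2 := ⟨⟨w, hwadd⟩, hwsmul⟩
  have hinner : ∀ p p', inner ℝ (w p) (w p') = ∑' s : ℕ, (p * p').eval (s : ℝ) * ρ s := by
    intro p p'
    rw [lp.inner_eq_tsum, ← tsum_sub (ρ := ρ)]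
    · refine tsum_congr fun s => ?_
      have h2 := Real.mul_self_sqrt (hρ s)
      simp only [hw, eval_mul, RCLike.inner_apply, conj_trivial]
      linear_combination (p.eval (s.1 : ℝ) * p'.eval (s.1 : ℝ)) * h2
    · intro s hs; simp [hs]
  let v : ℕ → lp (fun _ : S => ℝ) 2 := fun n => (√(h n))⁻¹ • w (q n)
  have hv : Orthonormal ℝ v := by
    rw [orthonormal_iff_ite]
    intro m n
    simp only [v, inner_smul_left, inner_smul_right, hinner, horth, conj_trivial]
    split_ifs with hmn
    · subst hmn
      have h2 := Real.mul_self_sqrt (hpos m).le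
      have h3 : √(h m) ≠ 0 := (Real.sqrt_pos.2 (hpos m)).ne'
      field_simp
      nlinarith
    · simp
  have hspanw : ∀ p, w p ∈ Submodule.span ℝ (Set.range v) := by
    have key : ∀ N : ℕ, ∀ p : ℝ[X], p.degree < N → w p ∈ Submodule.span ℝ (Set.range v) := by
      intro N
      induction N with
      | zero =>
        intro p hp
        have : p = 0 := by
          rw [← degree_eq_bot]; simpa using hp
        subst this
        rw [show w 0 = 0 from W.map_zero]
        exact Submodule.zero_mem _
      | succ N ih =>
        intro p hp
        have hq0 : (q N).coeff N ≠ 0 := by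
          have := hq N
          exact coeff_ne_zero_of_eq_degree this
        set r := p.coeff N / (q N).coeff N with hr
        have hd : (p - r • q N).degree < N := by
          rw [degree_lt_iff_coeff_zero]
          intro m hm
          rcases hm.eq_or_lt with rfl | hm
          · simp [hr, hq0]
          · rw [coeff_sub, coeff_smul, coeff_eq_zero_of_degree_lt (lt_of_lt_of_le hp (by exact_mod_cast hm)),
              coeff_eq_zero_of_degree_lt (by rw [hq]; exact_mod_cast hm)]
            simp
        have h1 := ih _ hd
        have h2 : w p = w (p - r • q N) + (r * √(h N)) • v N := by
          have : p = (p - r • q N) + r • q N := by ring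
          conv_lhs => rw [this]
          rw [hwadd, hwsmul]
          congr 1
          simp only [v, smul_smul]
          have h3 : √(h N) ≠ 0 := (Real.sqrt_pos.2 (hpos N)).ne'
          rw [mul_assoc, mul_inv_cancel₀ h3, mul_one]
        rw [h2]
        exact Submodule.add_mem _ h1 (Submodule.smul_mem _ _ (Submodule.subset_span ⟨N, rfl⟩))
    intro p
    exact key (p.natDegree + 1) p (by
      refine lt_of_le_of_lt degree_le_natDegree ?_
      exact_mod_cast Nat.lt_succ_self _)
  have hbot : (Submodule.span ℝ (Set.range v))ᗮ = ⊥ := by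
    rw [eq_bot_iff]
    intro g hg
    rw [Submodule.mem_orthogonal] at hg
    rw [Submodule.mem_bot]
    let b : ℕ → ℝ := fun s => if hs : ρ s ≠ 0 then g ⟨s, hs⟩ * √(ρ s) else 0
    have hb0 : ∀ s, ρ s = 0 → b s = 0 := by
      intro s hs; simp [b, hs]
    have hbS : ∀ s : S, b s = g s * √(ρ s) := by
      intro s
      simp only [b]
      rw [dif_pos s.2]
    have hbzero : b = 0 := by
      have ht' : 1 < √t := by rw [Real.lt_sqrt (by norm_num)]; simpa using ht
      apply power_zero b (√t) ht'
      · have hg2 : Summable fun s : S => (g s) ^ 2 := by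
          have := lp.memℓp g
          rw [memℓp_gen_iff (by norm_num)] at this
          refine this.congr fun s => ?_
          simp
        have hr2 : Summable fun s : S => |ρ s| * t ^ (s : ℕ) :=
          hs.comp_injective (i := (Subtype.val : S → ℕ)) Subtype.val_injective
        have h3 : Summable fun s : S => |b s| * √t ^ (s : ℕ) := by
          refine Summable.of_nonneg_of_le (fun s => by positivity) (fun s => ?_) (hg2.add hr2)
          rw [hbS, abs_mul, abs_of_nonneg (Real.sqrt_nonneg _), abs_of_nonneg (hρ s)]
          exact aux_ineq _ _ _ (hρ s) (by linarith) _
        have := (Function.Injective.summable_iff (f := fun s : ℕ => |b s| * √t ^ s)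
          (g := (Subtype.val : S → ℕ)) Subtype.val_injective ?_).1 h3
        · exact this
        · intro s hs
          have : ρ s = 0 := by
            by_contra hne; exact hs ⟨⟨s, hne⟩, rfl⟩
          simp [hb0 s this]
      · intro i
        obtain ⟨p, hp⟩ := exists_choose_poly i
        have := hg _ (hspanw p)
        rw [lp.inner_eq_tsum] at this
        refine (tsum_sub (ρ := ρ) _ ?_).symm.trans (Eq.trans ?_ this)
        rotate_left
        · refine tsum_congr fun s => ?_
          rw [hbS, ← hp]
          simp only [hw, RCLike.inner_apply, conj_trivial]
          ring
        · intro s hs; simp [hb0 s hs]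
    ext s
    have h1 := hbS s
    rw [hbzero] at h1
    have h3 : √(ρ s) ≠ 0 := (Real.sqrt_pos.2 (lt_of_le_of_ne (hρ s) (Ne.symm s.2))).ne'
    have : g s = 0 := by
      rcases mul_eq_zero.1 h1.symm with h | h
      · exact h
      · exact absurd h h3
    simpa using this
  let B := HilbertBasis.mkOfOrthogonalEqBot hv hbot
  have hB : ∀ n, B n = v n := fun n => congrFun (HilbertBasis.coe_mkOfOrthogonalEqBot hv hbot) n
  have hfin := B.hasSum_inner_mul_inner (lp.single 2 (⟨s0, hs0⟩ : S) (1 : ℝ))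
    (lp.single 2 (⟨s0, hs0⟩ : S) (1 : ℝ))
  simp only [lp.inner_single_left, lp.inner_single_right, hB] at hfin
  have hρ0 := Real.sq_sqrt (hρ s0)
  have h4 := hfin.div_const (ρ s0)
  have E2 : inner ℝ ((lp.single 2 (⟨s0, hs0⟩ : S) (1 : ℝ) : lp (fun _ : S => ℝ) 2) ⟨s0, hs0⟩) (1 : ℝ) / ρ s0
      = 1 / ρ s0 := by
    rw [lp.single_apply_self]; simp
  rw [E2] at h4
  refine Eq.subst (motive := fun f => HasSum f (1 / ρ s0)) (funext fun n => Eq.symm ?_) h4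
  have h2 := Real.sq_sqrt (hpos n).le
  have h3 : √(h n) ≠ 0 := (Real.sqrt_pos.2 (hpos n)).ne'
  have hvn : (v n : S → ℝ) ⟨s0, hs0⟩ = (√(h n))⁻¹ * (√(ρ s0) * (q n).eval (s0 : ℝ)) := rfl
  rw [hvn]
  simp only [RCLike.inner_apply, conj_trivial, one_mul, mul_one]
  have h5 := (hpos n).ne'
  rw [eq_div_iff hs0, div_mul_eq_mul_div, div_eq_iff h5]
  generalize √(h n) = x at *
  generalize √(ρ s0) = z at *
  rw [← h2, ← hρ0]
  field_simp


/-- `k × k` determinant of the family `M (n+l)` at the nodes `y`. -/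
noncomputable def Wdet (M : ℕ → ℝ[X]) {k : ℕ} (y : Fin k → ℝ) (n : ℕ) : ℝ :=
  Matrix.det (Matrix.of fun i l : Fin k => (M (n + (l : ℕ))).eval (y i))

/-- Christoffel determinant. -/
noncomputable def Qdet (M : ℕ → ℝ[X]) {k : ℕ} (y : Fin k → ℝ) (n : ℕ) (x : ℝ) : ℝ :=
  Matrix.det (Matrix.of fun i j : Fin (k + 1) =>
    (M (n + (j : ℕ))).eval (Fin.cons (α := fun _ => ℝ) x y i))

/-- minors -/
noncomputable def Wmin (M : ℕ → ℝ[X]) {k : ℕ} (y : Fin k → ℝ) (n : ℕ) (j : Fin (k + 1)) : ℝ :=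
  Matrix.det (Matrix.of fun i l : Fin k => (M (n + ((j.succAbove l : Fin (k + 1)) : ℕ))).eval (y i))

/-- polynomial version of `Qdet` -/
noncomputable def Qpol (M : ℕ → ℝ[X]) {k : ℕ} (y : Fin k → ℝ) (n : ℕ) : ℝ[X] :=
  ∑ j : Fin (k + 1), C ((-1) ^ (j : ℕ) * Wmin M y n j) * M (n + (j : ℕ))

lemma Qpol_eval (M : ℕ → ℝ[X]) {k : ℕ} (y : Fin k → ℝ) (n : ℕ) (x : ℝ) :
    (Qpol M y n).eval x = Qdet M y n x := by
  rw [Qdet, Matrix.det_succ_row_zero, Qpol, eval_finsetSum]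
  refine Finset.sum_congr rfl fun j _ => ?_
  rw [eval_mul, eval_C, Wmin]
  simp only [Matrix.of_apply, Fin.cons_zero]
  have : (Matrix.of fun i j : Fin (k + 1) =>
      (M (n + (j : ℕ))).eval (Fin.cons (α := fun _ => ℝ) x y i)).submatrix Fin.succ j.succAbove
      = Matrix.of fun i l : Fin k => (M (n + ((j.succAbove l : Fin (k + 1)) : ℕ))).eval (y i) := by
    ext i l
    simp [Matrix.submatrix]
  rw [this]; ring

lemma Wmin_zero (M : ℕ → ℝ[X]) {k : ℕ} (y : Fin k → ℝ) (n : ℕ) :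
    Wmin M y n 0 = Wdet M y (n + 1) := by
  rw [Wmin, Wdet]
  congr 1
  ext i l
  simp only [Matrix.of_apply, Fin.zero_succAbove, Fin.val_succ]
  rw [show n + ((l : ℕ) + 1) = n + 1 + l by ring]

lemma Wmin_last (M : ℕ → ℝ[X]) {k : ℕ} (y : Fin k → ℝ) (n : ℕ) :
    Wmin M y n (Fin.last k) = Wdet M y n := by
  rw [Wmin, Wdet]
  congr 1
  ext i l
  simp

lemma Qdet_node (M : ℕ → ℝ[X]) {k : ℕ} (y : Fin k → ℝ) (n : ℕ) (i : Fin k) :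
    Qdet M y n (y i) = 0 := by
  rw [Qdet]
  apply Matrix.det_zero_of_row_eq (i := 0) (j := i.succ) (Fin.succ_ne_zero i).symm
  ext j
  simp

lemma Wdet_zero_ne (M : ℕ → ℝ[X]) (hMd : ∀ n, (M n).natDegree ≤ n) (hℓ : ∀ n, (M n).coeff n ≠ 0)
    {k : ℕ} (y : Fin k → ℝ) (hy : Function.Injective y) : Wdet M y 0 ≠ 0 := by
  rw [Wdet]
  have h := Matrix.eval_matrixOfPolynomials_eq_vandermonde_mul_matrixOfPolynomials y
    (fun l : Fin k => M l) (fun i => hMd i)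
  have e : (Matrix.of fun i l : Fin k => (M (0 + (l : ℕ))).eval (y i))
      = Matrix.of fun i l : Fin k => (M (l : ℕ)).eval (y i) := by
    ext i l; simp
  rw [e, h, Matrix.det_mul]
  refine mul_ne_zero (Matrix.det_vandermonde_ne_zero_iff.2 hy) ?_
  rw [Matrix.det_of_isUpperTriangular]
  · rw [Finset.prod_ne_zero_iff]
    intro i _
    exact hℓ i
  · intro i j hij
    exact coeff_eq_zero_of_natDegree_lt (lt_of_le_of_lt (hMd _) hij)

theorem christoffel (μ : ℕ → ℝ) (t : ℝ) (ht : 1 < t) (hs : Summable fun s => |μ s| * t ^ s)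
    (hμ : ∀ s, μ s ≠ 0) (M : ℕ → ℝ[X]) (hMd : ∀ n, (M n).natDegree ≤ n)
    (hℓ : ∀ n, (M n).coeff n ≠ 0) (H : ℕ → ℝ) (hH : ∀ n, H n ≠ 0)
    (horth : ∀ n p, p.natDegree ≤ n → ∑' s : ℕ, (M n * p).eval (s : ℝ) * μ s = p.coeff n * H n)
    {k : ℕ} (y : Fin k → ℝ) (hy : Function.Injective y)
    (hpos : ∀ s : ℕ, 0 ≤ (∏ i, ((s : ℝ) - y i)) * μ s) :
    (∀ n, Wdet M y n ≠ 0) ∧ ∀ s : ℕ, ∏ i, ((s : ℝ) - y i) ≠ 0 →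
      HasSum (fun n => Qdet M y n s ^ 2 /
        ((-1) ^ k * Wdet M y n * Wdet M y (n + 1) * (M (n + k)).coeff (n + k) * H n))
        ((∏ i, ((s : ℝ) - y i)) / μ s) := by
  classical
  set P : ℝ[X] := ∏ i, (X - C (y i)) with hP
  have hPe : ∀ x : ℝ, P.eval x = ∏ i, (x - y i) := by
    intro x; simp [hP, eval_prod]
  have hPm : P.Monic := monic_prod_of_monic _ _ fun i _ => monic_X_sub_C _
  have hPd : P.natDegree = k := by
    rw [hP, natDegree_prod_of_monic _ _ fun i _ => monic_X_sub_C _]; simp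
  -- degree and leading coefficient of Qpol
  have hQd : ∀ n, (Qpol M y n).natDegree ≤ n + k := by
    intro n
    refine natDegree_sum_le_of_forall_le _ _ fun j _ => ?_
    refine (natDegree_C_mul_le _ _).trans ((hMd _).trans ?_)
    have := j.2; omega
  have hQc : ∀ n, (Qpol M y n).coeff (n + k) = (-1) ^ k * Wdet M y n * (M (n + k)).coeff (n + k) := by
    intro n
    rw [Qpol, finsetSum_coeff, Finset.sum_eq_single (Fin.last k)]
    · rw [coeff_C_mul, Wmin_last]; simp
    · intro j _ hj
      have : (j : ℕ) < k := Fin.val_lt_last hj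
      rw [coeff_C_mul, coeff_eq_zero_of_natDegree_lt (lt_of_le_of_lt (hMd _) (by omega)), mul_zero]
    · simp
  have hL : ∀ n p, p.natDegree ≤ n →
      ∑' s : ℕ, (Qpol M y n * p).eval (s : ℝ) * μ s = Wdet M y (n + 1) * (p.coeff n * H n) := by
    intro n p hp
    have e : ∀ s : ℕ, (Qpol M y n * p).eval (s : ℝ) * μ s
        = ∑ j : Fin (k + 1), ((-1) ^ (j : ℕ) * Wmin M y n j) *
            ((M (n + (j : ℕ)) * p).eval (s : ℝ) * μ s) := by
      intro s
      rw [Qpol, Finset.sum_mul, eval_finsetSum, Finset.sum_mul]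
      refine Finset.sum_congr rfl fun j _ => ?_
      simp only [eval_mul, eval_C]; ring
    simp_rw [e]
    rw [Summable.tsum_finsetSum fun j _ => (summable_poly_mul μ t ht hs _).mul_left _]
    simp_rw [tsum_mul_left]
    rw [Finset.sum_eq_single 0]
    · have := horth n p hp
      simp only [Wmin_zero, Fin.val_zero, Nat.add_zero, this, pow_zero, one_mul]
    · intro j _ hj
      have hj' : 0 < (j : ℕ) := Nat.pos_of_ne_zero (fun h => hj (Fin.ext h))
      rw [horth _ p (by omega), coeff_eq_zero_of_natDegree_lt (by omega)]; simp
    · simp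
  -- divisibility
  have hdvd : ∀ n, ∃ q, Qpol M y n = P * q := by
    intro n
    apply Finset.prod_dvd_of_coprime
    · intro i _ j _ hij
      exact pairwise_coprime_X_sub_C hy hij
    · intro i _
      rw [dvd_iff_isRoot, IsRoot.def, Qpol_eval, Qdet_node]
  choose q hq using hdvd
  have hqd : ∀ n, (q n).natDegree ≤ n := by
    intro n
    have h1 := hQd n
    by_cases h0 : q n = 0
    · simp [h0]
    rw [hq, hPm.natDegree_mul' h0, hPd] at h1
    omega
  have hqc : ∀ n, (q n).coeff n = (-1) ^ k * Wdet M y n * (M (n + k)).coeff (n + k) := by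
    intro n
    rw [← hQc, hq, add_comm n k, coeff_mul_add_eq_of_natDegree_le hPd.le (hqd n)]
    have : P.coeff k = 1 := by
      rw [← hPd]; exact hPm.coeff_natDegree
    rw [this, one_mul]
  set ρ : ℕ → ℝ := fun s => P.eval (s : ℝ) * μ s with hρ
  have hρ0 : ∀ s, 0 ≤ ρ s := by
    intro s; simp only [hρ, hPe]; exact hpos s
  have hLρ : ∀ n p, p.natDegree ≤ n →
      ∑' s : ℕ, (q n * p).eval (s : ℝ) * ρ s = Wdet M y (n + 1) * (p.coeff n * H n) := by
    intro n p hp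
    rw [← hL n p hp]
    refine tsum_congr fun s => ?_
    rw [hq]
    simp only [eval_mul, hρ]; ring
  have hsρ : ∀ p : ℝ[X], Summable fun s : ℕ => p.eval (s : ℝ) * ρ s := by
    intro p
    refine (summable_poly_mul μ t ht hs (p * P)).congr fun s => ?_
    simp only [eval_mul, hρ]; ring
  have hstep : ∀ n, Wdet M y (n + 1) = 0 → Wdet M y n = 0 := by
    intro n hn
    have h1 := hLρ n (q n) (hqd n)
    rw [hn, zero_mul] at h1
    have h2 : ∀ s : ℕ, 0 ≤ (q n * q n).eval (s : ℝ) * ρ s := by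
      intro s
      rw [eval_mul]
      exact mul_nonneg (mul_self_nonneg _) (hρ0 s)
    have h3 := (hasSum_zero_iff_of_nonneg h2).1 (h1 ▸ (hsρ (q n * q n)).hasSum)
    have h4 : q n * P = 0 := by
      apply Polynomial.eq_zero_of_infinite_isRoot
      refine Set.Infinite.mono ?_ (Set.infinite_range_of_injective (Nat.cast_injective (R := ℝ)))
      rintro _ ⟨s, rfl⟩
      have h5 := congrFun h3 s
      simp only [hρ, eval_mul, Pi.zero_apply, mul_eq_zero, hμ s, or_false] at h5
      simp only [Set.mem_ofPred_eq, IsRoot.def, eval_mul, mul_eq_zero]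
      tauto
    have h5 : q n = 0 := by
      rcases mul_eq_zero.1 h4 with h | h
      · exact h
      · exact absurd h hPm.ne_zero
    have h6 := hqc n
    rw [h5, coeff_zero] at h6
    have h7 := hℓ (n + k)
    have h8 : (-1 : ℝ) ^ k ≠ 0 := by positivity
    by_contra h9
    exact (mul_ne_zero (mul_ne_zero h8 h9) h7) h6.symm
  have hW : ∀ n, Wdet M y n ≠ 0 := by
    intro n
    induction n with
    | zero => exact Wdet_zero_ne M hMd hℓ y hy
    | succ n ih => exact fun h => ih (hstep n h)
  refine ⟨hW, fun s0 hs0 => ?_⟩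
  set h : ℕ → ℝ := fun n =>
    (-1) ^ k * Wdet M y n * Wdet M y (n + 1) * (M (n + k)).coeff (n + k) * H n with hh
  have hqq : ∀ n, ∑' s : ℕ, (q n * q n).eval (s : ℝ) * ρ s = h n := by
    intro n
    rw [hLρ n _ (hqd n), hqc, hh]; ring
  have hcn : ∀ n, (q n).coeff n ≠ 0 := by
    intro n
    rw [hqc]
    exact mul_ne_zero (mul_ne_zero (by positivity) (hW n)) (hℓ _)
  have hhpos : ∀ n, 0 < h n := by
    intro n
    refine lt_of_le_of_ne ?_ (Ne.symm ?_)
    · rw [← hqq]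
      refine tsum_nonneg fun s => ?_
      rw [eval_mul]
      exact mul_nonneg (mul_self_nonneg _) (hρ0 s)
    · rw [← hqq, hLρ n _ (hqd n)]
      exact mul_ne_zero (hW _) (mul_ne_zero (hcn n) (hH n))
  have hlt : ∀ m n, m < n → ∑' s : ℕ, (q n * q m).eval (s : ℝ) * ρ s = 0 := by
    intro m n hmn
    rw [hLρ n _ ((hqd m).trans hmn.le), coeff_eq_zero_of_natDegree_lt ((hqd m).trans_lt hmn)]
    simp
  obtain ⟨D, hD0, hD⟩ := poly_bound P (√t) (by rw [Real.lt_sqrt (by norm_num)]; simpa using ht)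
  have hfin := parseval_poly ρ hρ0 (√t) (by rw [Real.lt_sqrt (by norm_num)]; simpa using ht)
    (by
      refine Summable.of_nonneg_of_le (fun s => by positivity) (fun s => ?_) (hs.mul_left D)
      have e2 : √t ^ s * √t ^ s = t ^ s := by
        rw [← mul_pow, Real.mul_self_sqrt (by linarith)]
      rw [hρ, abs_mul, ← e2]
      have := hD s
      calc _ ≤ (D * √t ^ s) * |μ s| * √t ^ s := by gcongr
        _ = _ := by ring)
    q (fun n => degree_eq_of_le_of_coeff_ne_zero (degree_le_of_natDegree_le (hqd n)) (hcn n)) h hhpos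
    (by
      intro m n
      split_ifs with hmn
      · subst hmn; exact hqq m
      · rcases lt_or_gt_of_ne hmn with h1 | h1
        · rw [mul_comm]; exact hlt m n h1
        · exact hlt n m h1)
    s0 (by simp only [hρ, hPe]; exact mul_ne_zero hs0 (hμ s0))
  have h4 := hfin.mul_left ((P.eval (s0 : ℝ)) ^ 2)
  have E2 : (P.eval (s0 : ℝ)) ^ 2 * (1 / ρ s0) = (∏ i, ((s0 : ℝ) - y i)) / μ s0 := by
    have := hμ s0
    simp only [hρ, hPe]
    field_simp
  rw [E2] at h4
  refine Eq.subst (motive := fun f => HasSum f ((∏ i, ((s0 : ℝ) - y i)) / μ s0))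
    (funext fun n => Eq.symm ?_) h4
  rw [← Qpol_eval, hq, eval_mul, mul_pow, mul_div_assoc]


lemma gbinom_eq_choose (t : ℝ) (j : ℕ) : gbinom t j = Ring.choose t j := by
  rw [Ring.choose_eq_smul, gbinom, smul_eq_mul, div_eq_inv_mul]
  congr 1
  induction j with
  | zero => simp
  | succ j ih =>
    rw [Finset.prod_range_succ, ih, descPochhammer_succ_right, smeval_mul, smeval_sub, smeval_X,
      smeval_natCast]
    simp

lemma gbinom_nat (x j : ℕ) : gbinom (x : ℝ) j = (x.choose j : ℝ) := by
  rw [gbinom_eq_choose, Ring.choose_natCast]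

lemma gbinom_neg (t : ℝ) (j : ℕ) : gbinom (-t) j = (-1) ^ j * poch t j / j.factorial := by
  rw [gbinom, poch]
  congr 1
  have : ∀ i ∈ range j, (-t - (i : ℝ)) = (-1) * (t + i) := fun i _ => by ring
  rw [Finset.prod_congr rfl this, Finset.prod_mul_distrib]
  simp

lemma poch_add (c : ℝ) (i m : ℕ) : poch c (i + m) = poch c i * poch (c + i) m := by
  simp only [poch, Finset.prod_range_add]
  congr 1
  refine Finset.prod_congr rfl fun l _ => ?_
  push_cast; ring

lemma poch_ne_zero {c : ℝ} (hc : ∀ n : ℕ, c ≠ -(n : ℝ)) (n : ℕ) : poch c n ≠ 0 := by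
  rw [poch, Finset.prod_ne_zero_iff]
  intro i _ h
  exact hc i (by linarith)

lemma Gamma_add_nat {c : ℝ} (hc : ∀ n : ℕ, c ≠ -(n : ℝ)) (n : ℕ) :
    Real.Gamma (c + n) = poch c n * Real.Gamma c := by
  induction n with
  | zero => simp [poch]
  | succ n ih =>
    have h0 : c + n ≠ 0 := fun h => hc n (by linarith)
    rw [Nat.cast_succ, ← add_assoc, Real.Gamma_add_one h0, ih, poch, poch, Finset.prod_range_succ]
    ring

lemma hc_add {c : ℝ} (hc : ∀ n : ℕ, c ≠ -(n : ℝ)) (m : ℕ) : ∀ n : ℕ, c + m ≠ -(n : ℝ) := by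
  intro n h
  exact hc (n + m) (by push_cast; linarith)

/-- duality kernel -/
noncomputable def Sker (a c : ℝ) (n x : ℕ) : ℝ :=
  ∑ i ∈ range (n + x + 1), (n.choose i : ℝ) * (x.choose i : ℝ) * (i.factorial : ℝ) *
    (1 - a⁻¹) ^ i / poch c i

/-- duality factor -/
noncomputable def kap (a c : ℝ) (n : ℕ) : ℝ := (a / (a - 1)) ^ n * poch c n / n.factorial

lemma Sker_symm (a c : ℝ) (n x : ℕ) : Sker a c n x = Sker a c x n := by
  rw [Sker, Sker, add_comm n x]
  refine Finset.sum_congr rfl fun i _ => by ring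

lemma kap_ne_zero {a c : ℝ} (ha : a ≠ 0) (ha1 : a ≠ 1) (hc : ∀ n : ℕ, c ≠ -(n : ℝ)) (n : ℕ) :
    kap a c n ≠ 0 := by
  rw [kap]
  have : a - 1 ≠ 0 := sub_ne_zero.2 ha1
  have := poch_ne_zero hc n
  positivity

open PowerSeries in
lemma series_identity (a c : ℝ) (x n : ℕ) :
    ∑ j ∈ range (n + 1), a ^ (-(j : ℤ)) * gbinom x j * gbinom (-x - c) (n - j)
      = ∑ i ∈ range (x + 1), (x.choose i : ℝ) * (-(1 - a⁻¹)) ^ i *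
          (if i ≤ n then gbinom (-i - c) (n - i) else 0) := by
  have h1 : PowerSeries.coeff n ((1 + PowerSeries.C a⁻¹ * PowerSeries.X) ^ x * PowerSeries.binomialSeries ℝ (-x - c : ℝ) : PowerSeries ℝ)
      = ∑ j ∈ range (n + 1), a ^ (-(j : ℤ)) * gbinom x j * gbinom (-x - c) (n - j) := by
    rw [PowerSeries.coeff_mul, Finset.Nat.sum_antidiagonal_eq_sum_range_succ_mk]
    refine Finset.sum_congr rfl fun j _ => ?_
    have e : (1 + PowerSeries.C a⁻¹ * PowerSeries.X : PowerSeries ℝ) ^ x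
        = PowerSeries.rescale a⁻¹ (PowerSeries.binomialSeries ℝ (x : ℝ)) := by
      rw [binomialSeries_nat, map_pow, map_add, map_one, rescale_X]
    rw [e, coeff_rescale, binomialSeries_coeff, binomialSeries_coeff, gbinom_eq_choose, gbinom_eq_choose]
    simp
  rw [← h1]
  have h2 : ((1 + PowerSeries.C a⁻¹ * PowerSeries.X) ^ x * PowerSeries.binomialSeries ℝ (-x - c : ℝ) : PowerSeries ℝ)
      = ∑ i ∈ range (x + 1), PowerSeries.C ((x.choose i : ℝ) * (-(1 - a⁻¹)) ^ i) *
        (PowerSeries.X ^ i * PowerSeries.binomialSeries ℝ (-i - c : ℝ)) := by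
    have e : (1 + PowerSeries.C a⁻¹ * PowerSeries.X : PowerSeries ℝ)
        = PowerSeries.C (-(1 - a⁻¹)) * PowerSeries.X + (1 + PowerSeries.X) := by
      simp only [map_neg, map_sub, map_one]; ring
    rw [e, add_pow, Finset.sum_mul]
    refine Finset.sum_congr rfl fun i hi => ?_
    have hix : i ≤ x := by simpa [Nat.lt_succ_iff] using hi
    have e2 : PowerSeries.binomialSeries ℝ (-i - c : ℝ)
        = (1 + PowerSeries.X) ^ (x - i) * PowerSeries.binomialSeries ℝ (-x - c : ℝ) := by
      rw [← binomialSeries_nat (R := ℝ), ← binomialSeries_add]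
      congr 1
      push_cast [Nat.cast_sub hix]; ring
    rw [e2]
    simp only [map_mul, map_pow, map_natCast, mul_pow]
    ring
  rw [h2, map_sum]
  refine Finset.sum_congr rfl fun i _ => ?_
  rw [PowerSeries.coeff_C_mul, PowerSeries.coeff_X_pow_mul']
  split_ifs
  · rw [binomialSeries_coeff, gbinom_eq_choose]; simp
  · rfl

lemma meixner_dual {a c : ℝ} (ha : a ≠ 0) (ha1 : a ≠ 1) (hc : ∀ n : ℕ, c ≠ -(n : ℝ)) (n x : ℕ) :
    meixner a c n (x : ℝ) = kap a c n * Sker a c n x := by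
  rw [meixner, series_identity, Sker]
  rw [← Finset.sum_subset (s₁ := range (x + 1)) (s₂ := range (n + x + 1))]
  · rw [Finset.mul_sum, Finset.mul_sum]
    refine Finset.sum_congr rfl fun i _ => ?_
    split_ifs with hi
    · obtain ⟨m, rfl⟩ := Nat.exists_eq_add_of_le hi
      rw [show (-(i : ℝ) - c) = -(c + i) by ring, gbinom_neg, kap, poch_add,
        Nat.cast_choose ℝ hi, Nat.add_sub_cancel_left]
      have h1 := poch_ne_zero hc i
      have h2 : a - 1 ≠ 0 := sub_ne_zero.2 ha1
      have h3 : 1 - a ≠ 0 := sub_ne_zero.2 (Ne.symm ha1)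
      have h4 : a / (1 - a) = (-1) * (a / (a - 1)) := by
        field_simp; ring
      have h5 : (-(1 - a⁻¹)) ^ i = (-1) ^ i * (1 - a⁻¹) ^ i := by
        rw [← mul_pow]; ring
      have h6 : ((-1 : ℝ)) ^ i * (-1) ^ i = 1 := by rw [← mul_pow]; simp
      have h7 : ((-1 : ℝ)) ^ m * (-1) ^ m = 1 := by rw [← mul_pow]; simp
      rw [h4, h5, mul_pow, pow_add (-1 : ℝ)]
      field_simp
      linear_combination ((x.choose i : ℝ) * poch (c+i) m) * ((-1) ^ m * (-1) ^ m * h6 + h7)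
    · rw [Nat.choose_eq_zero_of_lt (by omega : n < i)]; simp
  · intro i; simp only [Finset.mem_range]; omega
  · intro i _ hi
    rw [Nat.choose_eq_zero_of_lt (by simpa using hi : x < i)]; simp

lemma meixner_swap {a c : ℝ} (ha : a ≠ 0) (ha1 : a ≠ 1) (hc : ∀ n : ℕ, c ≠ -(n : ℝ)) (n x : ℕ) :
    meixner a c n (x : ℝ) = kap a c n * ((kap a c x)⁻¹ * meixner a c x (n : ℝ)) := by
  rw [meixner_dual ha ha1 hc, meixner_dual ha ha1 hc x n, Sker_symm a c x n,
    inv_mul_cancel_left₀ (kap_ne_zero ha ha1 hc x)]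

lemma meixner_reflect {a : ℝ} (c : ℝ) (ha : a ≠ 0) (ha1 : a ≠ 1) (n : ℕ) (x : ℝ) :
    meixner a⁻¹ c n x = (-1) ^ n * meixner a c n (-c - x) := by
  rw [meixner, meixner, ← Finset.sum_range_reflect, Finset.mul_sum, Finset.mul_sum, Finset.mul_sum]
  refine Finset.sum_congr rfl fun j hj => ?_
  have hj' : j ≤ n := by simpa [Nat.lt_succ_iff] using hj
  obtain ⟨m, rfl⟩ := Nat.exists_eq_add_of_le hj'
  have e1 : j + m + 1 - 1 - j = m := by omega
  have e2 : j + m - m = j := by omega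
  have e3 : j + m - j = m := by omega
  rw [e1, e2, e3, show -(-c - x) - c = x by ring, show -x - c = -c - x by ring]
  have h2 : a - 1 ≠ 0 := sub_ne_zero.2 ha1
  have h3 : 1 - a ≠ 0 := sub_ne_zero.2 (Ne.symm ha1)
  have h4 : a⁻¹ / (1 - a⁻¹) = (-1) * ((1 - a)⁻¹) := by
    have : 1 - a⁻¹ ≠ 0 := by
      intro h; apply h2; field_simp at h; linarith
    field_simp; ring
  rw [h4, mul_pow, div_pow]
  simp only [zpow_neg, zpow_natCast, inv_pow, inv_inv, pow_add]
  field_simp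

lemma kap_inv {a : ℝ} (c : ℝ) (ha : a ≠ 0) (ha1 : a ≠ 1) (n : ℕ) :
    kap a c n = (-a) ^ n * kap a⁻¹ c n := by
  rw [kap, kap]
  have h2 : a - 1 ≠ 0 := sub_ne_zero.2 ha1
  have h4 : a / (a - 1) = (-a) * (a⁻¹ / (a⁻¹ - 1)) := by
    have : a⁻¹ - 1 ≠ 0 := by
      intro h; apply h2; field_simp at h; linarith
    have h3 : 1 - a ≠ 0 := sub_ne_zero.2 (Ne.symm ha1)
    field_simp; ring
  rw [h4, mul_pow]; ring

lemma meixner_swap2 {a c : ℝ} (ha : a ≠ 0) (ha1 : a ≠ 1) (hc : ∀ n : ℕ, c ≠ -(n : ℝ)) (f x j : ℕ) :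
    a ^ (-(j : ℤ)) * meixner a⁻¹ c f ((x : ℝ) + (j : ℝ)) =
      a ^ x * kap a⁻¹ c f * ((kap a c (x + j))⁻¹ * meixner a c (x + j) (-c - f)) := by
  have hi : a⁻¹ ≠ 0 := inv_ne_zero ha
  have hi1 : a⁻¹ ≠ 1 := by simpa using ha1
  rw [show (x : ℝ) + j = ((x + j : ℕ) : ℝ) by push_cast; rfl, meixner_swap hi hi1 hc,
    meixner_reflect c ha ha1 (x + j), kap_inv c ha ha1 (x + j)]
  have h1 := kap_ne_zero hi hi1 hc (x + j)
  rw [neg_pow a]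
  have h2 : ((-1 : ℝ)) ^ (x + j) ≠ 0 := by positivity
  have h3 : ((-1 : ℝ)) ^ (x + j) * (-1) ^ (x + j) = 1 := by rw [← mul_pow]; simp
  simp only [zpow_neg, zpow_natCast, pow_add a]
  generalize kap a⁻¹ c f = K at *
  generalize kap a⁻¹ c (x + j) = L at *
  field_simp
  generalize ((-1 : ℝ)) ^ (x + j) = u at *
  linear_combination (K * meixner a c (x + j) (-c - f)) * h3


lemma hasSum_cong {f g : ℕ → ℝ} {x : ℝ} (h : ∀ s, f s = g s) : HasSum f x ↔ HasSum g x := by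
  rw [funext h]

/-- the Meixner weight -/
noncomputable def muM (a c : ℝ) (s : ℕ) : ℝ := a ^ s * Real.Gamma ((s : ℝ) + c) / s.factorial

/-- the Meixner polynomial as a polynomial -/
noncomputable def mp (a c : ℝ) (n : ℕ) : ℝ[X] :=
  C ((a / (1 - a)) ^ n) * ∑ j ∈ range (n + 1), C (a ^ (-(j : ℤ))) *
    ((C ((j.factorial : ℝ)⁻¹) * ∏ i ∈ range j, (X - C (i : ℝ))) *
     (C (((n - j).factorial : ℝ)⁻¹) * ∏ i ∈ range (n - j), (-X - C c - C (i : ℝ))))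

lemma mp_eval (a c : ℝ) (n : ℕ) (x : ℝ) : (mp a c n).eval x = meixner a c n x := by
  simp only [mp, meixner, eval_mul, eval_finsetSum, eval_prod, eval_C, eval_sub, eval_X, eval_neg,
    gbinom, div_eq_inv_mul, mul_assoc]

lemma aux_deg1 (b : ℝ) : (X - C b : ℝ[X]).natDegree ≤ 1 := by compute_degree
lemma aux_deg2 (c b : ℝ) : (-X - C c - C b : ℝ[X]).natDegree ≤ 1 := by compute_degree

lemma aux_d1 (j : ℕ) :
    (C ((j.factorial : ℝ)⁻¹) * ∏ i ∈ range j, (X - C (i : ℝ)) : ℝ[X]).natDegree ≤ j := by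
  refine (natDegree_C_mul_le _ _).trans ((natDegree_prod_le _ _).trans ?_)
  refine (Finset.sum_le_card_nsmul _ _ 1 fun i _ => aux_deg1 _).trans ?_
  simp

lemma aux_d2 (c : ℝ) (j : ℕ) :
    (C ((j.factorial : ℝ)⁻¹) * ∏ i ∈ range j, (-X - C c - C (i : ℝ)) : ℝ[X]).natDegree ≤ j := by
  refine (natDegree_C_mul_le _ _).trans ((natDegree_prod_le _ _).trans ?_)
  refine (Finset.sum_le_card_nsmul _ _ 1 fun i _ => aux_deg2 _ _).trans ?_
  simp

lemma aux_c1 (j : ℕ) :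
    (C ((j.factorial : ℝ)⁻¹) * ∏ i ∈ range j, (X - C (i : ℝ)) : ℝ[X]).coeff j
      = (j.factorial : ℝ)⁻¹ := by
  have := coeff_prod_of_natDegree_le (range j) (fun i : ℕ => (X - C (i : ℝ) : ℝ[X])) 1
    (fun i _ => aux_deg1 _)
  rw [card_range, mul_one] at this
  rw [coeff_C_mul, this, Finset.prod_eq_one, mul_one]
  intro i _
  simp

lemma aux_c2 (c : ℝ) (j : ℕ) :
    (C ((j.factorial : ℝ)⁻¹) * ∏ i ∈ range j, (-X - C c - C (i : ℝ)) : ℝ[X]).coeff j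
      = (j.factorial : ℝ)⁻¹ * (-1) ^ j := by
  have := coeff_prod_of_natDegree_le (range j) (fun i : ℕ => (-X - C c - C (i : ℝ) : ℝ[X])) 1
    (fun i _ => aux_deg2 _ _)
  rw [card_range, mul_one] at this
  rw [coeff_C_mul, this, Finset.prod_congr rfl (g := fun _ => (-1 : ℝ))]
  · simp
  intro i _
  simp

lemma mp_natDegree (a c : ℝ) (n : ℕ) : (mp a c n).natDegree ≤ n := by
  refine (natDegree_C_mul_le _ _).trans (natDegree_sum_le_of_forall_le _ _ fun j hj => ?_)
  have hj' : j ≤ n := by simpa [Nat.lt_succ_iff] using hj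
  refine (natDegree_C_mul_le _ _).trans (natDegree_mul_le.trans ?_)
  have := aux_d1 j
  have := aux_d2 c (n - j)
  omega

lemma mp_coeff {a : ℝ} (c : ℝ) (ha : a ≠ 0) (ha1 : a ≠ 1) (n : ℕ) :
    (mp a c n).coeff n = (n.factorial : ℝ)⁻¹ := by
  have key : ∑ j ∈ range (n + 1), a ^ (-(j : ℤ)) *
      ((j.factorial : ℝ)⁻¹ * (((n - j).factorial : ℝ)⁻¹ * (-1) ^ (n - j)))
      = (a⁻¹ + -1) ^ n * (n.factorial : ℝ)⁻¹ := by
    rw [add_pow, Finset.sum_mul]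
    refine Finset.sum_congr rfl fun j hj => ?_
    have hj' : j ≤ n := by simpa [Nat.lt_succ_iff] using hj
    rw [Nat.cast_choose ℝ hj', zpow_neg, zpow_natCast, inv_pow]
    have h1 : (n.factorial : ℝ) ≠ 0 := by positivity
    field_simp
  rw [mp, coeff_C_mul, finsetSum_coeff]
  rw [Finset.sum_congr rfl (g := fun j : ℕ => a ^ (-(j : ℤ)) *
      ((j.factorial : ℝ)⁻¹ * (((n - j).factorial : ℝ)⁻¹ * (-1) ^ (n - j))))]
  · rw [key, ← mul_assoc, ← mul_pow]
    have h3 : 1 - a ≠ 0 := sub_ne_zero.2 (Ne.symm ha1)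
    have : a / (1 - a) * (a⁻¹ + -1) = 1 := by field_simp; ring
    rw [this]; simp
  · intro j hj
    have hj' : j ≤ n := by simpa [Nat.lt_succ_iff] using hj
    rw [coeff_C_mul]
    congr 1
    have := coeff_mul_add_eq_of_natDegree_le (aux_d1 j) (aux_d2 c (n - j))
    rw [Nat.add_sub_cancel' hj'] at this
    rw [this, aux_c1, aux_c2]

lemma muM_eq {a c : ℝ} (hc : ∀ n : ℕ, c ≠ -(n : ℝ)) (s : ℕ) :
    muM a c s = a ^ s * (poch c s * Real.Gamma c) / s.factorial := by
  rw [muM, add_comm, Gamma_add_nat hc]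

lemma Gamma_ne {c : ℝ} (hc : ∀ n : ℕ, c ≠ -(n : ℝ)) : Real.Gamma c ≠ 0 := Real.Gamma_ne_zero hc

lemma muM_ne_zero {a c : ℝ} (ha : a ≠ 0) (hc : ∀ n : ℕ, c ≠ -(n : ℝ)) (s : ℕ) : muM a c s ≠ 0 := by
  rw [muM_eq hc]
  have := poch_ne_zero hc s
  have := Gamma_ne hc
  positivity

lemma muM_hasSum {a c : ℝ} (ha0 : 0 < a) (ha1 : a < 1) (hc : ∀ n : ℕ, c ≠ -(n : ℝ)) :
    HasSum (muM a c) (Real.Gamma c / (1 - a) ^ c) := by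
  have h := (Real.one_add_rpow_hasFPowerSeriesOnBall_zero (a := -c)).hasSum (y := -a) (by
    simp only [Metric.mem_eball, edist_zero_right, enorm_neg]
    rw [← ofReal_norm, Real.norm_eq_abs, abs_of_pos ha0]
    simpa using ha1)
  simp only [binomialSeries_apply, zero_add] at h
  have h2 := h.mul_left (Real.Gamma c)
  rw [Real.rpow_neg (by linarith), ← sub_eq_add_neg, ← div_eq_mul_inv] at h2
  refine (hasSum_cong fun s => ?_).2 h2
  rw [muM_eq hc, ← gbinom_eq_choose, gbinom_neg]
  have h6 : ((-1 : ℝ)) ^ s * (-1) ^ s = 1 := by rw [← mul_pow]; simp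
  simp only [List.ofFn_const, List.prod_replicate, smul_eq_mul]
  rw [neg_pow a]
  linear_combination (-(a ^ s * (poch c s * Real.Gamma c) / s.factorial)) * h6

lemma muM_summable {a c : ℝ} (ha0 : 0 < a) (ha1 : a < 1) (hc : ∀ n : ℕ, c ≠ -(n : ℝ)) :
    Summable fun s => |muM a c s| * (2 / (1 + a)) ^ s := by
  have ht : 0 < 2 / (1 + a) := by positivity
  refine summable_of_ratio_test_tendsto_lt_one (l := a * (2 / (1 + a))) ?_ ?_ ?_
  · rw [← mul_div_assoc, div_lt_one (by positivity)]; linarith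
  · refine Filter.Eventually.of_forall fun s => ?_
    have := abs_pos.2 (muM_ne_zero ha0.ne' hc s)
    positivity
  · have h1 : Filter.Tendsto (fun s : ℕ => |c + s| / ((s : ℝ) + 1)) Filter.atTop (nhds 1) := by
      have h2 : Filter.Tendsto (fun s : ℕ => |1 + (c - 1) * (1 / ((s : ℝ) + 1))|) Filter.atTop
          (nhds |1 + (c - 1) * 0|) :=
        (((tendsto_one_div_add_atTop_nhds_zero_nat (𝕜 := ℝ)).const_mul (c - 1)).const_add 1).abs
      rw [mul_zero, add_zero, abs_one] at h2
      refine h2.congr fun s => ?_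
      have hs : (0 : ℝ) < (s : ℝ) + 1 := by positivity
      rw [show 1 + (c - 1) * (1 / ((s : ℝ) + 1)) = (c + s) / ((s : ℝ) + 1) by
        field_simp; ring, abs_div, abs_of_pos hs]
    have h3 := h1.mul_const (a * (2 / (1 + a)))
    rw [one_mul] at h3
    refine h3.congr fun s => ?_
    have hm : |muM a c (s + 1)| = |muM a c s| * (a * (|c + s| / ((s : ℝ) + 1))) := by
      have hs : (0 : ℝ) < (s : ℝ) + 1 := by positivity
      have : muM a c (s + 1) = muM a c s * (a * ((c + s) / ((s : ℝ) + 1))) := by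
        rw [muM_eq hc, muM_eq hc, poch_add, Nat.factorial_succ]
        simp only [poch, Finset.prod_range_one]
        push_cast
        field_simp
        ring
      rw [this, abs_mul, abs_mul, abs_div, abs_of_pos ha0, abs_of_pos hs]
    have h4 := abs_pos.2 (muM_ne_zero ha0.ne' hc s)
    simp only [norm_mul, Real.norm_eq_abs, abs_abs, abs_pow]
    rw [hm, abs_of_pos ht, pow_succ]
    field_simp

lemma fwd_poly (n : ℕ) (p : ℝ[X]) (hp : p.natDegree ≤ n) (y : ℝ) :
    ∑ j ∈ range (n + 1), ((-1 : ℝ) ^ (n - j) * n.choose j) * p.eval (y + j)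
      = p.coeff n * n.factorial := by
  have h := fwdDiff_iter_eq_sum_shift (1 : ℝ) p.eval n y
  have h2 : (fwdDiff (1 : ℝ))^[n] p.eval y = p.coeff n * n.factorial := by
    rcases hp.lt_or_eq with h | rfl
    · rw [Polynomial.fwdDiff_iter_eq_zero_of_degree_lt h, coeff_eq_zero_of_natDegree_lt h]; simp
    · rw [Polynomial.fwdDiff_iter_degree_eq_factorial]; simp
  rw [← h2, h]
  refine Finset.sum_congr rfl fun j _ => ?_
  simp

lemma term_shift {a c : ℝ} (ha : a ≠ 0) (hc : ∀ n : ℕ, c ≠ -(n : ℝ)) (n j : ℕ) (hj : j ≤ n)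
    (y : ℕ) :
    a ^ (-(j : ℤ)) * gbinom ((y + j : ℕ) : ℝ) j * gbinom (-((y + j : ℕ) : ℝ) - c) (n - j) *
      muM a c (y + j) = (-1) ^ (n - j) * n.choose j / n.factorial * muM a (c + n) y := by
  obtain ⟨m, rfl⟩ := Nat.exists_eq_add_of_le hj
  have e3 : j + m - j = m := by omega
  have hc' := hc_add hc (y + j)
  have hG : Real.Gamma ((y : ℝ) + (c + (j + m : ℕ)))
      = poch (c + (y + j : ℕ)) m * Real.Gamma (c + (y + j : ℕ)) := by
    rw [← Gamma_add_nat hc']; congr 1; push_cast; ring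
  rw [e3, gbinom_nat, show -((y + j : ℕ) : ℝ) - c = -(c + (y + j : ℕ)) by ring, gbinom_neg, muM,
    muM, hG, Nat.cast_choose ℝ hj, e3, Nat.cast_choose ℝ (Nat.le_add_left j y), Nat.add_sub_cancel, zpow_neg, zpow_natCast,
    add_comm ((y + j : ℕ) : ℝ) c]
  rw [pow_add]
  have h1 : ((y + j).factorial : ℝ) ≠ 0 := by positivity
  have h2 : ((j + m).factorial : ℝ) ≠ 0 := by positivity
  field_simp

lemma meixner_orth {a c : ℝ} (ha0 : 0 < a) (ha1 : a < 1) (hc : ∀ n : ℕ, c ≠ -(n : ℝ)) (n : ℕ)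
    (p : ℝ[X]) (hp : p.natDegree ≤ n) :
    ∑' s : ℕ, (mp a c n * p).eval (s : ℝ) * muM a c s
      = p.coeff n * ((a / (1 - a)) ^ n * (Real.Gamma (c + n) / (1 - a) ^ (c + n))) := by
  have hcn := hc_add hc n
  have ht : 1 < 2 / (1 + a) := by rw [lt_div_iff₀ (by positivity)]; linarith
  have hterm : ∀ j ∈ range (n + 1), HasSum (fun s : ℕ =>
      a ^ (-(j : ℤ)) * gbinom (s : ℝ) j * gbinom (-(s : ℝ) - c) (n - j) * muM a c s * p.eval (s : ℝ))
      (∑' y : ℕ, (-1) ^ (n - j) * n.choose j / n.factorial * (p.eval ((y : ℝ) + j) * muM a (c + n) y)) := by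
    intro j hj
    have hj' : j ≤ n := by simpa [Nat.lt_succ_iff] using hj
    have hsum : Summable fun y : ℕ => p.eval ((y : ℝ) + j) * muM a (c + n) y := by
      have := summable_poly_mul (muM a (c + n)) _ ht (muM_summable ha0 ha1 hcn) (p.comp (X + C (j : ℝ)))
      simpa using this
    have h := (hsum.mul_left ((-1) ^ (n - j) * n.choose j / n.factorial : ℝ)).hasSum
    have h2 := (hasSum_nat_add_iff (f := fun s : ℕ =>
      a ^ (-(j : ℤ)) * gbinom (s : ℝ) j * gbinom (-(s : ℝ) - c) (n - j) * muM a c s * p.eval (s : ℝ)) j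
      (g := ∑' y : ℕ, (-1) ^ (n - j) * n.choose j / n.factorial * (p.eval ((y : ℝ) + j) * muM a (c + n) y))).1
      (by
        refine (hasSum_cong fun y => ?_).2 h
        rw [term_shift ha0.ne' hc n j hj']
        push_cast
        ring)
    rw [Finset.sum_eq_zero, add_zero] at h2
    · exact h2
    · intro i hi
      rw [gbinom_nat, Nat.choose_eq_zero_of_lt (by simpa using hi)]
      simp
  have hall := (hasSum_sum hterm).mul_left ((a / (1 - a)) ^ n)
  have e1 : (fun s : ℕ => (mp a c n * p).eval (s : ℝ) * muM a c s) = fun s : ℕ => (a / (1 - a)) ^ n *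
      ∑ j ∈ range (n + 1), a ^ (-(j : ℤ)) * gbinom (s : ℝ) j * gbinom (-(s : ℝ) - c) (n - j) *
        muM a c s * p.eval (s : ℝ) := by
    funext s
    rw [eval_mul, mp_eval, meixner, ← Finset.sum_mul, ← Finset.sum_mul]
    ring
  rw [e1, hall.tsum_eq]
  have hs : ∀ j ∈ range (n + 1), Summable fun y : ℕ =>
      ((-1) ^ (n - j) * n.choose j / n.factorial * (p.eval ((y : ℝ) + j) * muM a (c + n) y) : ℝ) := by
    intro j _
    have := summable_poly_mul (muM a (c + n)) _ ht (muM_summable ha0 ha1 hcn) (p.comp (X + C (j : ℝ)))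
    exact Summable.mul_left _ (by simpa using this)
  rw [← Summable.tsum_finsetSum hs]
  have e2 : ∀ y : ℕ, ∑ j ∈ range (n + 1), ((-1) ^ (n - j) * n.choose j / n.factorial *
      (p.eval ((y : ℝ) + j) * muM a (c + n) y) : ℝ) = p.coeff n * muM a (c + n) y := by
    intro y
    have h1 : (n.factorial : ℝ) ≠ 0 := by positivity
    have := fwd_poly n p hp y
    rw [show p.coeff n * muM a (c + n) y = (p.coeff n * n.factorial) * (muM a (c + n) y / n.factorial) by
      field_simp, ← this, Finset.sum_mul]
    refine Finset.sum_congr rfl fun j _ => by ring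
  simp only [e2]
  rw [tsum_mul_left, (muM_hasSum ha0 ha1 hcn).tsum_eq]
  ring


lemma nth_eq (F : Finset ℕ) (i : Fin F.card) : nth F (i : ℕ) = F.orderEmbOfFin rfl i := by
  rw [nth, Finset.orderEmbOfFin_apply, List.getD_eq_getElem]
  rfl

lemma nth_mem (F : Finset ℕ) {i : ℕ} (hi : i < F.card) : nth F i ∈ F := by
  have := nth_eq F ⟨i, hi⟩
  simp only at this
  rw [this]
  exact Finset.orderEmbOfFin_mem _ _ _

lemma nth_inj (F : Finset ℕ) {i j : ℕ} (hi : i < F.card) (hj : j < F.card)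
    (h : nth F i = nth F j) : i = j := by
  have h1 := nth_eq F ⟨i, hi⟩
  have h2 := nth_eq F ⟨j, hj⟩
  simp only at h1 h2
  rw [h1, h2] at h
  have := (F.orderEmbOfFin rfl).injective h
  simpa using this

lemma prod_nth (F : Finset ℕ) (g : ℕ → ℝ) : ∏ i : Fin F.card, g (nth F (i : ℕ)) = ∏ f ∈ F, g f := by
  rw [← Finset.prod_coe_sort F g]
  refine Fintype.prod_equiv (F.orderIsoOfFin rfl).toEquiv _ _ fun i => ?_
  rw [nth_eq]
  simp

/-- the nodes -/
noncomputable def yM (c : ℝ) (F1 F2 : Finset ℕ) (i : Fin (F1.card + F2.card)) : ℝ :=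
  if (i : ℕ) < F1.card then (nth F1 i : ℝ) else -c - (nth F2 ((i : ℕ) - F1.card) : ℝ)

lemma yM_inj {c : ℝ} (hc : ∀ n : ℕ, c ≠ -(n : ℝ)) (F1 F2 : Finset ℕ) :
    Function.Injective (yM c F1 F2) := by
  intro i j h
  have hi := i.2
  have hj := j.2
  simp only [yM] at h
  apply Fin.ext
  split_ifs at h with h1 h2 h2
  · exact nth_inj F1 h1 h2 (by exact_mod_cast h)
  · exfalso
    apply hc (nth F1 i + nth F2 ((j : ℕ) - F1.card))
    push_cast; linarith
  · exfalso
    apply hc (nth F1 j + nth F2 ((i : ℕ) - F1.card))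
    push_cast; linarith
  · have := nth_inj F2 (i := i - F1.card) (j := j - F1.card) (by omega) (by omega)
      (by have : (nth F2 ((i : ℕ) - F1.card) : ℝ) = nth F2 ((j : ℕ) - F1.card) := by linarith
          exact_mod_cast this)
    omega

lemma prod_yM (c : ℝ) (F1 F2 : Finset ℕ) (s : ℝ) :
    ∏ i, (s - yM c F1 F2 i) = (∏ f ∈ F1, (s - (f : ℝ))) * ∏ f ∈ F2, (s + c + (f : ℝ)) := by
  rw [Fin.prod_univ_add, ← prod_nth F1 (fun f => s - (f : ℝ)), ← prod_nth F2 (fun f => s + c + (f : ℝ))]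
  congr 1
  · refine Finset.prod_congr rfl fun i _ => ?_
    simp [yM]
  · refine Finset.prod_congr rfl fun i _ => ?_
    simp [yM]; ring

lemma posM {a c : ℝ} (ha0 : 0 < a) (hc : ∀ n : ℕ, c ≠ -(n : ℝ)) (F1 F2 : Finset ℕ)
    (hadm : IsAdmissible c F1 F2) (s : ℕ) :
    0 ≤ (∏ i, ((s : ℝ) - yM c F1 F2 i)) * muM a c s := by
  have h := hadm s
  rw [← prod_yM] at h
  have hcs : ∀ n : ℕ, (s : ℝ) + c ≠ -(n : ℝ) := by
    rw [add_comm]; exact hc_add hc s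
  have hG := Gamma_add_nat hcs (chat c)
  have hp := poch_ne_zero hcs (chat c)
  have hpos : 0 < (s : ℝ) + c + chat c := by
    have h1 : -c ≤ (chat c : ℝ) := by
      have h2 : (-⌊c⌋ : ℤ) ≤ (chat c : ℤ) := Int.self_le_toNat _
      have h3 : ((-⌊c⌋ : ℤ) : ℝ) ≤ ((chat c : ℤ) : ℝ) := by exact_mod_cast h2
      have h4 := Int.floor_le c
      push_cast at h3
      linarith
    have h5 : c ≠ -(chat c : ℝ) := hc _
    have h6 : 0 ≤ c + chat c := by linarith
    have h7 : c + chat c ≠ 0 := fun h => h5 (by linarith)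
    have h8 : 0 < c + chat c := lt_of_le_of_ne h6 h7.symm
    have h9 : (0 : ℝ) ≤ s := by positivity
    linarith
  have hGp := Real.Gamma_pos_of_pos hpos
  have e : (∏ i, ((s : ℝ) - yM c F1 F2 i)) * muM a c s =
      (∏ i, ((s : ℝ) - yM c F1 F2 i)) / poch ((s : ℝ) + c) (chat c) *
        (a ^ s * Real.Gamma ((s : ℝ) + c + chat c) / s.factorial) := by
    rw [muM, hG]; field_simp
  rw [e]
  exact mul_nonneg h (by positivity)

/-- row factors -/
noncomputable def nuM (a c : ℝ) (F1 F2 : Finset ℕ) (x : ℕ) (i : Fin (F1.card + F2.card)) : ℝ :=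
  if (i : ℕ) < F1.card then kap a c (nth F1 i) else
    a ^ x * kap a⁻¹ c (nth F2 ((i : ℕ) - F1.card))

lemma prod_nuM_succ (a c : ℝ) (F1 F2 : Finset ℕ) (x : ℕ) :
    ∏ i, nuM a c F1 F2 (x + 1) i = a ^ F2.card * ∏ i, nuM a c F1 F2 x i := by
  rw [Fin.prod_univ_add, Fin.prod_univ_add]
  simp only [nuM, Fin.val_castAdd, Fin.is_lt, if_true, Fin.val_natAdd, Nat.not_lt.2 (Nat.le_add_right _ _),
    if_false, pow_succ, Finset.prod_mul_distrib, Finset.prod_const, Finset.card_univ, Fintype.card_fin]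
  ring

lemma nuM_ne {a c : ℝ} (ha : a ≠ 0) (ha1 : a ≠ 1) (hc : ∀ n : ℕ, c ≠ -(n : ℝ)) (F1 F2 : Finset ℕ)
    (x : ℕ) : ∏ i, nuM a c F1 F2 x i ≠ 0 := by
  rw [Finset.prod_ne_zero_iff]
  intro i _
  have hi : a⁻¹ ≠ 0 := inv_ne_zero ha
  have hi1 : a⁻¹ ≠ 1 := by simpa using ha1
  rw [nuM]
  split_ifs
  · exact kap_ne_zero ha ha1 hc _
  · exact mul_ne_zero (pow_ne_zero _ ha) (kap_ne_zero hi hi1 hc _)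

lemma OmegaM_eq {a c : ℝ} (ha : a ≠ 0) (ha1 : a ≠ 1) (hc : ∀ n : ℕ, c ≠ -(n : ℝ)) (F1 F2 : Finset ℕ)
    (x : ℕ) : OmegaM a c F1 F2 (x : ℝ) = (∏ i, nuM a c F1 F2 x i) *
      ((∏ j ∈ range (F1.card + F2.card), (kap a c (x + j))⁻¹) * Wdet (mp a c) (yM c F1 F2) x) := by
  rw [Wdet, Finset.prod_range, ← Matrix.det_mul_row, ← Matrix.det_mul_column, OmegaM]
  congr 1
  ext i j
  simp only [Matrix.of_apply, mp_eval, nuM, yM]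
  split_ifs with h
  · rw [← Nat.cast_add, meixner_swap ha ha1 hc]
  · rw [meixner_swap2 ha ha1 hc]

lemma mExc_eq {a c : ℝ} (ha : a ≠ 0) (ha1 : a ≠ 1) (hc : ∀ n : ℕ, c ≠ -(n : ℝ)) (F1 F2 : Finset ℕ)
    (r x : ℕ) : mExc a c F1 F2 r (x : ℝ) = (kap a c (r - uF F1 F2) * ∏ i, nuM a c F1 F2 x i) *
      ((∏ j ∈ range (F1.card + F2.card + 1), (kap a c (x + j))⁻¹) *
        Qdet (mp a c) (yM c F1 F2) x ((r - uF F1 F2 : ℕ) : ℝ)) := by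
  have e : kap a c (r - uF F1 F2) * ∏ i, nuM a c F1 F2 x i = ∏ i : Fin (F1.card + F2.card + 1),
      (Fin.cons (α := fun _ => ℝ) (kap a c (r - uF F1 F2)) (nuM a c F1 F2 x) i) := by
    rw [Fin.prod_univ_succ]; simp
  rw [e, Qdet, Finset.prod_range, ← Matrix.det_mul_row, ← Matrix.det_mul_column, mExc]
  congr 1
  ext i j
  simp only [Matrix.of_apply, mp_eval]
  refine Fin.cases ?_ (fun i => ?_) i
  · simp only [Fin.val_zero, if_true, Fin.cons_zero]
    rw [← Nat.cast_add, meixner_swap ha ha1 hc]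
  · simp only [Fin.val_succ, Nat.succ_ne_zero, if_false, Fin.cons_succ, Nat.add_sub_cancel, nuM, yM]
    split_ifs with h
    · rw [← Nat.cast_add, meixner_swap ha ha1 hc]
    · rw [meixner_swap2 ha ha1 hc]


/-- constant in the norm identity -/
noncomputable def cstM (a c : ℝ) (k k2 s : ℕ) : ℝ :=
  kap a c s ^ 2 * Real.Gamma c ^ 2 * ((1 - a) / a) ^ k / (a ^ k2 * (1 - a) ^ c)

lemma summand_eq {a c : ℝ} (ha0 : 0 < a) (ha1 : a < 1) (hc : ∀ n : ℕ, c ≠ -(n : ℝ))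
    (F1 F2 : Finset ℕ) (r x : ℕ)
    (hW : ∀ n, Wdet (mp a c) (yM c F1 F2) n ≠ 0) :
    mExc a c F1 F2 r (x : ℝ) ^ 2 * wM a c F1 F2 x =
      cstM a c (F1.card + F2.card) F2.card (r - uF F1 F2) *
      (Qdet (mp a c) (yM c F1 F2) x ((r - uF F1 F2 : ℕ) : ℝ) ^ 2 /
        ((-1) ^ (F1.card + F2.card) * Wdet (mp a c) (yM c F1 F2) x *
          Wdet (mp a c) (yM c F1 F2) (x + 1) *
          (mp a c (x + (F1.card + F2.card))).coeff (x + (F1.card + F2.card)) *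
          ((a / (1 - a)) ^ x * (Real.Gamma (c + x) / (1 - a) ^ (c + x))))) := by
  have ha := ha0.ne'
  have ha' := ha1.ne
  have hx1 : (x : ℝ) + 1 = ((x + 1 : ℕ) : ℝ) := by push_cast; rfl
  rw [wM, hx1, OmegaM_eq ha ha' hc, OmegaM_eq ha ha' hc, mExc_eq ha ha' hc, mp_coeff c ha ha',
    prod_nuM_succ]
  generalize r - uF F1 F2 = s
  have hN := nuM_ne ha ha' hc F1 F2 x
  have hW0 := hW x
  have hW1 := hW (x + 1)
  generalize Wdet (mp a c) (yM c F1 F2) x = W0 at *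
  generalize Wdet (mp a c) (yM c F1 F2) (x + 1) = W1 at *
  generalize Qdet (mp a c) (yM c F1 F2) x (s : ℝ) = Q at *
  generalize (∏ i, nuM a c F1 F2 x i) = N at *
  clear hW
  generalize F1.card + F2.card = k
  generalize F2.card = k2
  have hA1 : ∏ j ∈ range (k + 1), (kap a c (x + j))⁻¹ =
      (∏ j ∈ range k, (kap a c (x + j))⁻¹) * (kap a c (x + k))⁻¹ := Finset.prod_range_succ _ _
  have hA2 : ∏ j ∈ range (k + 1), (kap a c (x + j))⁻¹ =
      (∏ j ∈ range k, (kap a c (x + 1 + j))⁻¹) * (kap a c x)⁻¹ := by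
    rw [Finset.prod_range_succ']
    simp only [add_zero, add_assoc, add_comm 1]
  have hB1 : ∏ j ∈ range k, (kap a c (x + j))⁻¹ ≠ 0 :=
    Finset.prod_ne_zero_iff.2 fun j _ => inv_ne_zero (kap_ne_zero ha ha' hc _)
  have hB2 : ∏ j ∈ range k, (kap a c (x + 1 + j))⁻¹ ≠ 0 :=
    Finset.prod_ne_zero_iff.2 fun j _ => inv_ne_zero (kap_ne_zero ha ha' hc _)
  have hAA : (∏ j ∈ range (k + 1), (kap a c (x + j))⁻¹) ^ 2 =
      (∏ j ∈ range k, (kap a c (x + j))⁻¹) * (kap a c (x + k))⁻¹ *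
      ((∏ j ∈ range k, (kap a c (x + 1 + j))⁻¹) * (kap a c x)⁻¹) := by
    rw [← hA1, ← hA2, sq]
  generalize (∏ j ∈ range (k + 1), (kap a c (x + j))⁻¹) = A at *
  generalize (∏ j ∈ range k, (kap a c (x + j))⁻¹) = B1 at *
  generalize (∏ j ∈ range k, (kap a c (x + 1 + j))⁻¹) = B2 at *
  have hK1 := kap_ne_zero ha ha' hc (x + k)
  have hK2 := kap_ne_zero ha ha' hc x
  have step1 : (kap a c s * N * (A * Q)) ^ 2 *
      (a ^ x * Real.Gamma ((x : ℝ) + c + (k : ℝ)) /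
        ((x.factorial : ℝ) * (N * (B1 * W0)) * (a ^ k2 * N * (B2 * W1)))) =
      kap a c s ^ 2 / a ^ k2 * (Q ^ 2 / (W0 * W1)) * (a ^ x * Real.Gamma ((x : ℝ) + c + (k : ℝ)) /
        (x.factorial * (kap a c (x + k) * kap a c x))) := by
    have : (kap a c s * N * (A * Q)) ^ 2 = kap a c s ^ 2 * N ^ 2 * Q ^ 2 * A ^ 2 := by ring
    rw [this, hAA]
    field_simp
  rw [step1, cstM]
  have hG1 : Real.Gamma ((x : ℝ) + c + (k : ℝ)) = poch c (x + k) * Real.Gamma c := by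
    rw [← Gamma_add_nat hc]; congr 1; push_cast; ring
  rw [hG1, Gamma_add_nat hc x]
  have h1a : (0 : ℝ) < 1 - a := by linarith
  rw [Real.rpow_add h1a, Real.rpow_natCast]
  have hrp : (1 - a) ^ c ≠ 0 := (Real.rpow_pos_of_pos h1a c).ne'
  generalize (1 - a) ^ c = R at *
  have hp1 := poch_ne_zero hc (x + k)
  have hp2 := poch_ne_zero hc x
  have hG := Gamma_ne hc
  have hK : kap a c (x + k) * kap a c x = (-1) ^ k * (a / (1 - a)) ^ (x + k) * (a / (1 - a)) ^ x *
      (poch c (x + k) / (x + k).factorial) * (poch c x / x.factorial) := by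
    have h4 : a / (a - 1) = (-1) * (a / (1 - a)) := by
      have : a - 1 ≠ 0 := by linarith
      field_simp; ring
    have h6 : ((-1 : ℝ)) ^ x * (-1) ^ x = 1 := by rw [← mul_pow]; simp
    rw [kap, kap, h4, mul_pow, mul_pow, pow_add (-1 : ℝ)]
    linear_combination ((-1) ^ k * (a / (1 - a)) ^ (x + k) * (a / (1 - a)) ^ x *
      (poch c (x + k) / (x + k).factorial) * (poch c x / x.factorial)) * h6
  rw [hK]
  generalize kap a c s = K
  have hm : ((-1 : ℝ)) ^ k ≠ 0 := by positivity
  have hf : ((x + k).factorial : ℝ) ≠ 0 := by positivity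
  generalize ((-1 : ℝ)) ^ k = u at *
  generalize ((x + k).factorial : ℝ) = fk at *
  generalize poch c (x + k) = p1 at *
  generalize poch c x = p2 at *
  generalize Real.Gamma c = G at *
  simp only [div_pow, pow_add]
  have h1 : (1 - a) ^ x ≠ 0 := by positivity
  have h2 : (1 - a) ^ k ≠ 0 := by positivity
  generalize (1 - a) ^ x = bx at *
  generalize (1 - a) ^ k = bk at *
  field_simp

theorem main_thm (a c : ℝ) (ha0 : 0 < a) (ha1 : a < 1)
    (hc : ∀ n : ℕ, c ≠ -(n : ℝ))
    (F1 F2 : Finset ℕ) 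
    (hadm : IsAdmissible c F1 F2)
    (r : ℕ) (hr : r ∈ sigmaF F1 F2) :
    ∑' n : ℕ, (mExc a c F1 F2 r (n : ℝ)) ^ 2 * wM a c F1 F2 n =
      a ^ ((F1.card : ℤ) - 2 * ((F1.card : ℤ) + (F2.card : ℤ))) /
        (1 - a) ^ (c + 2 * (r : ℝ) - 2 * (uF F1 F2 : ℝ) - ((F1.card + F2.card : ℕ) : ℝ)) *
      ((∏ f ∈ F1, ((r : ℝ) - (f : ℝ) - (uF F1 F2 : ℝ))) *
        (∏ f ∈ F2, ((r : ℝ) + c + (f : ℝ) - (uF F1 F2 : ℝ))) *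
        a ^ (r - uF F1 F2) * Real.Gamma ((r : ℝ) + c - (uF F1 F2 : ℝ)) /
        (Nat.factorial (r - uF F1 F2) : ℝ)) := by
  have ha := ha0.ne'
  have ha' := ha1.ne
  have h1a : (0 : ℝ) < 1 - a := by linarith
  have ht : 1 < 2 / (1 + a) := by rw [lt_div_iff₀ (by positivity)]; linarith
  obtain ⟨hur, hrf⟩ := hr
  obtain ⟨hW, hS⟩ := christoffel (muM a c) (2 / (1 + a)) ht (muM_summable ha0 ha1 hc)
    (muM_ne_zero ha hc) (mp a c) (mp_natDegree a c)
    (fun n => by rw [mp_coeff c ha ha']; positivity)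
    (fun n => (a / (1 - a)) ^ n * (Real.Gamma (c + n) / (1 - a) ^ (c + n)))
    (fun n => by
      have h1 := Gamma_ne (hc_add hc n)
      have h2 := (Real.rpow_pos_of_pos h1a (c + n)).ne'
      positivity)
    (fun n p hp => meixner_orth ha0 ha1 hc n p hp)
    (yM c F1 F2) (yM_inj hc F1 F2) (posM ha0 hc F1 F2 hadm)
  have hs : ((r - uF F1 F2 : ℕ) : ℝ) = (r : ℝ) - uF F1 F2 := Nat.cast_sub hur
  have hP : ∏ i, (((r - uF F1 F2 : ℕ) : ℝ) - yM c F1 F2 i) ≠ 0 := by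
    rw [prod_yM]
    refine mul_ne_zero ?_ ?_
    · rw [Finset.prod_ne_zero_iff]
      intro f hf h
      have : r - uF F1 F2 = f := by
        have : ((r - uF F1 F2 : ℕ) : ℝ) = f := by linarith
        exact_mod_cast this
      exact hrf f hf (by omega)
    · rw [Finset.prod_ne_zero_iff]
      intro f hf h
      exact hc (r - uF F1 F2 + f) (by push_cast; linarith)
  have h := (hS (r - uF F1 F2) hP).mul_left (cstM a c (F1.card + F2.card) F2.card (r - uF F1 F2))
  simp only [summand_eq ha0 ha1 hc F1 F2 r _ hW]
  rw [h.tsum_eq, prod_yM]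
  have e1 : ∏ f ∈ F1, ((r : ℝ) - (f : ℝ) - (uF F1 F2 : ℝ)) =
      ∏ f ∈ F1, (((r - uF F1 F2 : ℕ) : ℝ) - (f : ℝ)) :=
    Finset.prod_congr rfl fun f _ => by rw [hs]; ring
  have e2 : ∏ f ∈ F2, ((r : ℝ) + c + (f : ℝ) - (uF F1 F2 : ℝ)) =
      ∏ f ∈ F2, (((r - uF F1 F2 : ℕ) : ℝ) + c + (f : ℝ)) :=
    Finset.prod_congr rfl fun f _ => by rw [hs]; ring
  have e3 : (r : ℝ) + c - (uF F1 F2 : ℝ) = c + ((r - uF F1 F2 : ℕ) : ℝ) := by rw [hs]; ring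
  have e4 : c + 2 * (r : ℝ) - 2 * (uF F1 F2 : ℝ) - ((F1.card + F2.card : ℕ) : ℝ)
      = c + ((2 * (r - uF F1 F2) : ℕ) : ℝ) - ((F1.card + F2.card : ℕ) : ℝ) := by
    rw [Nat.cast_mul, hs]; push_cast; ring
  have e5 : ((F1.card : ℤ) - 2 * ((F1.card : ℤ) + (F2.card : ℤ)))
      = -((F2.card + (F1.card + F2.card) : ℕ) : ℤ) := by push_cast; ring
  rw [e1, e2, e3, e4, e5, Gamma_add_nat hc, muM_eq hc, cstM, kap]
  clear hS h hP hs e1 e2 e3 e4 e5 hW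
  generalize r - uF F1 F2 = s
  generalize (∏ f ∈ F1, ((s : ℝ) - (f : ℝ))) = P1
  generalize (∏ f ∈ F2, ((s : ℝ) + c + (f : ℝ))) = P2
  generalize F1.card + F2.card = k
  rw [Real.rpow_sub h1a, Real.rpow_add h1a, Real.rpow_natCast, Real.rpow_natCast, zpow_neg,
    zpow_natCast, pow_mul, pow_add]
  have hrp : (1 - a) ^ c ≠ 0 := (Real.rpow_pos_of_pos h1a c).ne'
  have hp := poch_ne_zero hc s
  have hG := Gamma_ne hc
  have h4 : (a / (a - 1)) ^ s * (a / (a - 1)) ^ s = (a / (1 - a)) ^ s * (a / (1 - a)) ^ s := by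
    have : a / (a - 1) = (-1) * (a / (1 - a)) := by
      have : a - 1 ≠ 0 := by linarith
      field_simp; ring
    rw [this, ← mul_pow, ← mul_pow]; congr 1; ring
  have h5 : ((a / (a - 1)) ^ s * poch c s / s.factorial) ^ 2
      = (a / (1 - a)) ^ s * (a / (1 - a)) ^ s * (poch c s / s.factorial) ^ 2 := by
    rw [← h4]; ring
  rw [h5]
  generalize (1 - a) ^ c = R at *
  generalize poch c s = p at *
  generalize Real.Gamma c = G at *
  simp only [div_pow, ← pow_mul, mul_comm 2 s]
  rw [pow_mul]
  have h1 : (1 - a) ^ s ≠ 0 := by positivity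
  have h2 : (1 - a) ^ k ≠ 0 := by positivity
  generalize (1 - a) ^ s = bx at *
  generalize (1 - a) ^ k = bk at *
  field_simp

/-- The norm identity (4.13): for admissible `c` and `𝓕` and every `r ∈ σ_𝓕`,
`⟨m_r^𝓕, m_r^𝓕⟩_{ω_{a,c}^𝓕} = a^{k₁-2k} (1-a)^{-(c+2r-2u_𝓕-k)} ρ_{a,c}^𝓕(r)`. -/
theorem meixner_exceptional_norm (a c : ℝ) (ha0 : 0 < a) (ha1 : a < 1)
    (hc : ∀ n : ℕ, c ≠ -(n : ℝ))
    (F1 F2 : Finset ℕ) (hF1 : ∀ f ∈ F1, 0 < f) (hF2 : ∀ f ∈ F2, 0 < f)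
    (hne : F1.Nonempty ∨ F2.Nonempty)
    (hadm : IsAdmissible c F1 F2)
    (r : ℕ) (hr : r ∈ sigmaF F1 F2) :
    ∑' n : ℕ, (mExc a c F1 F2 r (n : ℝ)) ^ 2 * wM a c F1 F2 n =
      a ^ ((F1.card : ℤ) - 2 * ((F1.card : ℤ) + (F2.card : ℤ))) /
        (1 - a) ^ (c + 2 * (r : ℝ) - 2 * (uF F1 F2 : ℝ) - ((F1.card + F2.card : ℕ) : ℝ)) *
      ((∏ f ∈ F1, ((r : ℝ) - (f : ℝ) - (uF F1 F2 : ℝ))) *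
        (∏ f ∈ F2, ((r : ℝ) + c + (f : ℝ) - (uF F1 F2 : ℝ))) *
        a ^ (r - uF F1 F2) * Real.Gamma ((r : ℝ) + c - (uF F1 F2 : ℝ)) /
        (Nat.factorial (r - uF F1 F2) : ℝ)) := by
  exact main_thm a c ha0 ha1 hc F1 F2 hadm r hr
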